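/- arXiv:2501.00831 — 7 statements merged into one kernel-verified Lean document; each statement's English description precedes it below -/
import Mathlib

section
/- For every n ≥ 2, the hazard-free sensitivity, hazard-free block sensitivity, and hazard-free certificate complexity of the multiplexer function all equal 2^n: s_u(MUX_n) = bs_u(MUX_n) = cc_u(MUX_n) = 2^n. -/
/-- Kleene's three-valued domain: `none` is the unstable value `u`,
`some b` is a stable Boolean value. -/
abbrev K : Type := Option Bool

namespace HF

variable {ι : Type} [Fintype ι] [DecidableEq ι]

/-- Instability order on inputs: `Below x y` means `x ≤ y`, i.e. each coordinate of `x`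
is either `u` or equal to the corresponding coordinate of `y`. -/
def Below (x y : ι → K) : Prop := ∀ i, x i = none ∨ x i = y i

/-- `x` is strictly below `y` in the instability order. -/
def StrictBelow (x y : ι → K) : Prop := Below x y ∧ x ≠ y

/-- `y` is strictly above `x` in the instability order. -/
def StrictAbove (y x : ι → K) : Prop := Below x y ∧ y ≠ x

/-- `x : ι → Bool` is a resolution of `y : ι → K`. -/
def Resolves (y : ι → K) (x : ι → Bool) : Prop := ∀ i, y i = none ∨ y i = some (x i)

instance (y : ι → K) : DecidablePred (Resolves y) := fun x => by
  unfold Resolves; infer_instance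

/-- The hazard-free extension of a Boolean function `f`. -/
def hfExt (f : (ι → Bool) → Bool) (y : ι → K) : K :=
  if ∀ x, Resolves y x → f x = true then some true
  else if ∀ x, Resolves y x → f x = false then some false
  else none

/-- Number of unstable (`u`) coordinates of an input. -/
def numU (x : ι → K) : ℕ := (Finset.univ.filter fun i => x i = none).card

/-- Ternary (hazard-free) decision trees: leaves are labeled by values in `K`,
internal nodes query a position and have children for responses `0`, `u`, `1`. -/
inductive TDT (ι : Type) : Type where
  | leaf : K → TDT ι
  | node : ι → TDT ι → TDT ι → TDT ι → TDT ι

namespace TDT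

/-- Evaluate a ternary decision tree on an input in `K^ι`. -/
def eval : TDT ι → (ι → K) → K
  | .leaf b, _ => b
  | .node i t0 tu t1, x =>
    match x i with
    | some false => eval t0 x
    | none => eval tu x
    | some true => eval t1 x

/-- Depth of a ternary decision tree. -/
def depth : TDT ι → ℕ
  | .leaf _ => 0
  | .node _ t0 tu t1 => max (max (depth t0) (depth tu)) (depth t1) + 1

/-- Size (number of leaves) of a ternary decision tree. -/
def size : TDT ι → ℕ
  | .leaf _ => 1
  | .node _ t0 tu t1 => size t0 + size tu + size t1

end TDT

/-- Boolean decision trees. -/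
inductive BDT (ι : Type) : Type where
  | leaf : Bool → BDT ι
  | node : ι → BDT ι → BDT ι → BDT ι

namespace BDT

/-- Evaluate a Boolean decision tree. -/
def eval : BDT ι → (ι → Bool) → Bool
  | .leaf b, _ => b
  | .node i t0 t1, x => if x i then eval t1 x else eval t0 x

/-- Depth of a Boolean decision tree. -/
def depth : BDT ι → ℕ
  | .leaf _ => 0
  | .node _ t0 t1 => max (depth t0) (depth t1) + 1

/-- Size (number of leaves) of a Boolean decision tree. -/
def size : BDT ι → ℕ
  | .leaf _ => 1
  | .node _ t0 t1 => size t0 + size t1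

end BDT

/-- A ternary tree computes (the hazard-free extension of) the Boolean function `f`. -/
def ComputesHF (f : (ι → Bool) → Bool) (T : TDT ι) : Prop := ∀ x, T.eval x = hfExt f x

/-- A ternary tree computes a `K`-valued function `g`. -/
def ComputesT (g : (ι → K) → K) (T : TDT ι) : Prop := ∀ x, T.eval x = g x

/-- A Boolean tree computes the Boolean function `f`. -/
def ComputesB (f : (ι → Bool) → Bool) (T : BDT ι) : Prop := ∀ x, T.eval x = f x

/-- A `k`-bit hazard-free decision tree for `f`: correct on all inputs with at most
`k` unstable coordinates. -/
def KComputes (k : ℕ) (f : (ι → Bool) → Bool) (T : TDT ι) : Prop :=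
  ∀ x : ι → K, numU x ≤ k → T.eval x = hfExt f x

/-- Minimum depth of a ternary decision tree computing a `K`-valued function. -/
noncomputable def depthT (g : (ι → K) → K) : ℕ :=
  sInf {d | ∃ T : TDT ι, ComputesT g T ∧ T.depth = d}

/-- Hazard-free decision tree depth of a Boolean function. -/
noncomputable def depthU (f : (ι → Bool) → Bool) : ℕ :=
  sInf {d | ∃ T : TDT ι, ComputesHF f T ∧ T.depth = d}

/-- Hazard-free decision tree size (minimum number of leaves). -/
noncomputable def sizeU (f : (ι → Bool) → Bool) : ℕ :=
  sInf {s | ∃ T : TDT ι, ComputesHF f T ∧ T.size = s}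

/-- Boolean decision tree size (minimum number of leaves). -/
noncomputable def sizeB (f : (ι → Bool) → Bool) : ℕ :=
  sInf {s | ∃ T : BDT ι, ComputesB f T ∧ T.size = s}

/-- The multiplexer function `MUX n` on `n` selector bits and `2^n` data bits. -/
def MUX (n : ℕ) (z : (Fin n ⊕ (Fin n → Bool)) → Bool) : Bool :=
  z (Sum.inr fun i => z (Sum.inl i))

/-- Hazard-free sensitivity of `g` at `x`. -/
noncomputable def sensAt (g : (ι → K) → K) (x : ι → K) : ℕ :=
  Set.ncard {i : ι | ∃ y : ι → K, y i ≠ x i ∧ (∀ j, j ≠ i → y j = x j) ∧ g y ≠ g x}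

/-- Hazard-free sensitivity of `g`. -/
noncomputable def sens (g : (ι → K) → K) : ℕ := ⨆ x : ι → K, sensAt g x

/-- Hazard-free sensitivity of `g` restricted to inputs with output value `b`. -/
noncomputable def sensVal (g : (ι → K) → K) (b : K) : ℕ :=
  ⨆ x : {x : ι → K // g x = b}, sensAt g x.1

/-- Hazard-free block sensitivity of `g` at `x`. -/
noncomputable def bsensAt (g : (ι → K) → K) (x : ι → K) : ℕ :=
  sSup {k : ℕ | ∃ B : Fin k → Finset ι, (∀ j, (B j).Nonempty) ∧
    (∀ j j', j ≠ j' → Disjoint (B j) (B j')) ∧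
    ∀ j, ∃ y : ι → K, (∀ i, y i ≠ x i ↔ i ∈ B j) ∧ g y ≠ g x}

/-- Hazard-free block sensitivity of `g`. -/
noncomputable def bsens (g : (ι → K) → K) : ℕ := ⨆ x, bsensAt g x

/-- Hazard-free certificate complexity of `g` at `x`. -/
noncomputable def ccAt (g : (ι → K) → K) (x : ι → K) : ℕ :=
  sInf {k : ℕ | ∃ S : Finset ι, S.card = k ∧
    ∀ y : ι → K, (∀ i ∈ S, y i = x i) → g y = g x}

/-- Hazard-free certificate complexity of `g`. -/
noncomputable def cc (g : (ι → K) → K) : ℕ := ⨆ x, ccAt g x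

/-- Hazard-free certificate complexity of `g` restricted to inputs with output value `b`. -/
noncomputable def ccVal (g : (ι → K) → K) (b : K) : ℕ :=
  ⨆ x : {x : ι → K // g x = b}, ccAt g x.1

/-- Boolean sensitivity of a Boolean function. -/
noncomputable def boolSens (f : (ι → Bool) → Bool) : ℕ :=
  ⨆ x : ι → Bool, Set.ncard {i : ι | f (Function.update x i (!(x i))) ≠ f x}

/-- `p` is a prime implicant of `f`. -/
def PrimeImplicant (f : (ι → Bool) → Bool) (p : ι → K) : Prop :=
  hfExt f p = some true ∧ ∀ q, StrictBelow q p → hfExt f q ≠ some true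

/-- `p` is a prime implicate of `f`. -/
def PrimeImplicate (f : (ι → Bool) → Bool) (p : ι → K) : Prop :=
  hfExt f p = some false ∧ ∀ q, StrictBelow q p → hfExt f q ≠ some false

/-- Size of an implicant/implicate: the number of stable coordinates. -/
noncomputable def isize (p : ι → K) : ℕ := Set.ncard {i : ι | p i ≠ none}

/-- Hamming distance between two inputs in `K^ι`. -/
noncomputable def hamm (x y : ι → K) : ℕ := Set.ncard {i : ι | x i ≠ y i}

/-- Hazard-free evaluation of a literal (variable and polarity). -/
def litEval (x : ι → K) (l : ι × Bool) : K := if l.2 then x l.1 else (x l.1).map not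

/-- Hazard-free evaluation of a term (conjunction of literals). -/
def termEval (t : Finset (ι × Bool)) (x : ι → K) : K :=
  if ∀ l ∈ t, litEval x l = some true then some true
  else if ∃ l ∈ t, litEval x l = some false then some false
  else none

/-- Hazard-free evaluation of a clause (disjunction of literals). -/
def clauseEval (c : Finset (ι × Bool)) (x : ι → K) : K :=
  if ∃ l ∈ c, litEval x l = some true then some true
  else if ∀ l ∈ c, litEval x l = some false then some false
  else none

/-- Hazard-free evaluation of a DNF formula (a set of terms). -/
def dnfEval (D : Finset (Finset (ι × Bool))) (x : ι → K) : K :=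
  if ∃ t ∈ D, termEval t x = some true then some true
  else if ∀ t ∈ D, termEval t x = some false then some false
  else none

/-- Hazard-free evaluation of a CNF formula (a set of clauses). -/
def cnfEval (C : Finset (Finset (ι × Bool))) (x : ι → K) : K :=
  if ∀ c ∈ C, clauseEval c x = some true then some true
  else if ∃ c ∈ C, clauseEval c x = some false then some false
  else none

/-- A function `g : K^ι → K` is weakly hazard-free: it is monotone with respect to the
instability order, and whenever all points strictly above `x` have the same value `b`
(and some such point exists), `g x = b` as well. -/
def WeaklyHF (g : (ι → K) → K) : Prop :=
  (∀ x y, Below x y → g x = none ∨ g x = g y) ∧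
  (∀ x (b : K), (∃ y, StrictAbove y x) → (∀ y, StrictAbove y x → g y = b) → g x = b)

/-- The subcube `C(x)` is monochromatic for `f`. -/
def Mono (f : (ι → Bool) → Bool) (x : ι → K) : Prop :=
  ∀ y z : ι → Bool, Resolves x y → Resolves x z → f y = f z

/-- The subcube `C(x)` is colorful for `f` (contains both a 0-point and a 1-point). -/
def Colorful (f : (ι → Bool) → Bool) (x : ι → K) : Prop :=
  ∃ y z : ι → Bool, Resolves x y ∧ Resolves x z ∧ f y ≠ f z

/-- `C(x)` is a minimal colorful cube for `f`. -/
def MinColorful (f : (ι → Bool) → Bool) (x : ι → K) : Prop :=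
  Colorful f x ∧ ∀ i, x i = none →
    (Mono f (Function.update x i (some false)) ∨ Mono f (Function.update x i (some true)))

/-- A Boolean function is non-degenerate if it depends on every input position. -/
def Nondegenerate (f : (ι → Bool) → Bool) : Prop :=
  ∀ i : ι, ∃ x y : ι → Bool, (∀ j, j ≠ i → x j = y j) ∧ x i ≠ y i ∧ f x ≠ f y

/-- The `n`-input AND function. -/
def ANDf (n : ℕ) (x : Fin n → Bool) : Bool := decide (∀ i, x i = true)

lemma exists_resolves (y : ι → K) : ∃ x, Resolves y x :=
  ⟨fun i => (y i).getD false, fun i => by cases h : y i <;> simp [h]⟩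

lemma hfExt_eq_some_iff (f : (ι → Bool) → Bool) (y : ι → K) (b : Bool) :
    hfExt f y = some b ↔ ∀ x, Resolves y x → f x = b := by
  obtain ⟨x₀, hx₀⟩ := exists_resolves y
  unfold hfExt
  cases b
  · split_ifs with h₁ h₂
    · simpa using ⟨x₀, hx₀, h₁ x₀ hx₀⟩
    · simpa using h₂
    · simpa using h₂
  · split_ifs with h₁ h₂
    · simpa using h₁
    · simpa using ⟨x₀, hx₀, h₂ x₀ hx₀⟩
    · simpa using h₁

/-- Disjoint sensitive blocks inject into any certificate. -/
lemma le_card_of_blocks {g : (ι → K) → K} {x : ι → K} {S : Finset ι}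
    (hS : ∀ y : ι → K, (∀ i ∈ S, y i = x i) → g y = g x) {k : ℕ} {B : Fin k → Finset ι}
    (hdisj : ∀ j j', j ≠ j' → Disjoint (B j) (B j'))
    (hB : ∀ j, ∃ y : ι → K, (∀ i, y i ≠ x i ↔ i ∈ B j) ∧ g y ≠ g x) : k ≤ S.card := by
  have hmeet : ∀ j, ∃ i, i ∈ S ∧ i ∈ B j := by
    intro j
    obtain ⟨y, hy, hne⟩ := hB j
    by_contra! h
    exact hne (hS y fun i hi => not_not.1 (mt (hy i).1 (h i hi)))
  choose i hiS hiB using hmeet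
  simpa using Finset.card_le_card_of_injOn (s := Finset.univ) i (fun j _ => hiS j)
    fun j _ j' _ h => by
      by_contra hne
      exact Finset.disjoint_left.1 (hdisj j j' hne) (hiB j) (h ▸ hiB j')

lemma exists_certificate_card_eq_ccAt (g : (ι → K) → K) (x : ι → K) :
    ∃ S : Finset ι, S.card = ccAt g x ∧ ∀ y : ι → K, (∀ i ∈ S, y i = x i) → g y = g x :=
  Nat.sInf_mem (s := {k : ℕ | ∃ S : Finset ι, S.card = k ∧
    ∀ y : ι → K, (∀ i ∈ S, y i = x i) → g y = g x})
    ⟨_, Finset.univ, rfl, fun _ hy => congrArg g (funext fun i => hy i (Finset.mem_univ i))⟩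

lemma bsensAt_le_ccAt (g : (ι → K) → K) (x : ι → K) : bsensAt g x ≤ ccAt g x := by
  obtain ⟨S, hcard, hS⟩ := exists_certificate_card_eq_ccAt g x
  refine csSup_le' ?_
  rintro k ⟨B, -, hdisj, hB⟩
  exact hcard ▸ le_card_of_blocks hS hdisj hB

lemma sensAt_le_bsensAt (g : (ι → K) → K) (x : ι → K) : sensAt g x ≤ bsensAt g x := by
  obtain ⟨S, -, hS⟩ := exists_certificate_card_eq_ccAt g x
  refine le_csSup ⟨S.card, ?_⟩ ?_
  · rintro k ⟨B, -, hdisj, hB⟩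
    exact le_card_of_blocks hS hdisj hB
  · let e := Finite.equivFin
      {i : ι | ∃ y : ι → K, y i ≠ x i ∧ (∀ j, j ≠ i → y j = x j) ∧ g y ≠ g x}
    refine ⟨fun j => {(e.symm j).1}, fun j => Finset.singleton_nonempty _, ?_, ?_⟩
    · intro j j' hne
      rw [Finset.disjoint_singleton]
      exact fun h => hne (e.symm.injective (Subtype.ext h))
    · intro j
      obtain ⟨y, hi, hy, hne⟩ := (e.symm j).2
      refine ⟨y, fun i => ?_, hne⟩
      rw [Finset.mem_singleton]
      exact ⟨fun h => not_not.1 (mt (hy i) h), fun h => h ▸ hi⟩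

lemma sens_le_bsens (g : (ι → K) → K) : sens g ≤ bsens g :=
  ciSup_mono (Set.finite_range _).bddAbove (sensAt_le_bsensAt g)

lemma bsens_le_cc (g : (ι → K) → K) : bsens g ≤ cc g :=
  ciSup_mono (Set.finite_range _).bddAbove (bsensAt_le_ccAt g)

/-- The stable positions of `s`, together with its resolutions, number at most `2 ^ |ι|`. -/
lemma card_stable_add_card_resolutions_le (s : ι → K) :
    (Finset.univ.filter fun i => s i ≠ none).card + (Finset.univ.filter (Resolves s)).card
      ≤ 2 ^ Fintype.card ι := by
  obtain ⟨a, ha⟩ := exists_resolves s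
  have hinj : Function.Injective fun i => Function.update a i (!a i) := by
    intro i j h
    by_contra hne
    simpa [Function.update_of_ne hne] using congrFun h i
  rw [← Finset.card_image_of_injective _ hinj, ← Finset.card_union_of_disjoint]
  · exact (Finset.card_le_univ _).trans (by simp)
  · rw [Finset.disjoint_left]
    intro c hc hres
    obtain ⟨i, hi, rfl⟩ := Finset.mem_image.1 hc
    have hi' : s i ≠ none := (Finset.mem_filter.1 hi).2
    have h₁ := (ha i).resolve_left hi'
    have h₂ := ((Finset.mem_filter.1 hres).2 i).resolve_left hi'
    simp [h₁] at h₂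

lemma hfExt_MUX_eq_some_iff {n : ℕ} (x : Fin n ⊕ (Fin n → Bool) → K) (b : Bool) :
    hfExt (MUX n) x = some b ↔
      ∀ a, Resolves (fun i => x (Sum.inl i)) a → x (Sum.inr a) = some b := by
  rw [hfExt_eq_some_iff]
  constructor
  · intro h a ha
    have hr := h (Sum.elim a fun c => (x (Sum.inr c)).getD (!b)) <| by
      rintro (i | c)
      · exact ha i
      · cases hc : x (Sum.inr c) <;> simp [hc]
    cases hc : x (Sum.inr a) <;> simp_all [MUX]
  · intro h r hr
    have h₁ := h (fun i => r (Sum.inl i)) fun i => hr (Sum.inl i)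
    have h₂ := hr (Sum.inr fun i => r (Sum.inl i))
    simpa [h₁, MUX, eq_comm] using h₂

lemma ccAt_MUX_le {n : ℕ} (hn : 2 ≤ n) (x : Fin n ⊕ (Fin n → Bool) → K) :
    ccAt (hfExt (MUX n)) x ≤ 2 ^ n := by
  suffices h : ∃ S : Finset (Fin n ⊕ (Fin n → Bool)), S.card ≤ 2 ^ n ∧
      ∀ y, (∀ i ∈ S, y i = x i) → hfExt (MUX n) y = hfExt (MUX n) x by
    obtain ⟨S, hcard, hS⟩ := h
    exact le_trans (Nat.sInf_le ⟨S, rfl, hS⟩) hcard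
  cases hx : hfExt (MUX n) x with
  | some b =>
    refine ⟨(Finset.univ.filter fun i => x (Sum.inl i) ≠ none).disjSum
      (Finset.univ.filter (Resolves fun i => x (Sum.inl i))), ?_, fun y hy => ?_⟩
    · simpa [Finset.card_disjSum] using
        card_stable_add_card_resolutions_le fun i => x (Sum.inl i)
    · rw [hfExt_MUX_eq_some_iff] at hx ⊢
      intro a ha
      have ha' : Resolves (fun i => x (Sum.inl i)) a := by
        intro i
        by_cases hi : x (Sum.inl i) = none
        · exact Or.inl hi
        · have := hy (Sum.inl i) (by simpa using hi)
          simpa [this] using ha i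
      rw [hy (Sum.inr a) (by simpa using ha'), hx a ha']
  | none =>
    have hex : ∀ b, ∃ a, Resolves (fun i => x (Sum.inl i)) a ∧ x (Sum.inr a) ≠ some b := by
      intro b
      have h := mt (hfExt_MUX_eq_some_iff x b).2
      simpa [hx] using h
    choose a ha hab using hex
    refine ⟨Finset.univ.disjSum (Finset.univ.image a), ?_, fun y hy => ?_⟩
    · have h₁ : (Finset.univ.image a).card ≤ 2 := by
        simpa using Finset.card_image_le (s := Finset.univ) (f := a)
      have h₂ : n + 2 ≤ 2 ^ n := by
        obtain ⟨m, rfl⟩ := Nat.exists_eq_add_of_le hn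
        have := Nat.lt_two_pow_self (n := m)
        rw [pow_add]
        omega
      simp only [Finset.card_disjSum, Finset.card_univ, Fintype.card_fin]
      omega
    · have hsel : ∀ i, y (Sum.inl i) = x (Sum.inl i) := fun i => hy _ (by simp)
      rw [Option.eq_none_iff_forall_ne_some]
      intro b hb
      rw [hfExt_MUX_eq_some_iff] at hb
      refine hab b ?_
      rw [← hy (Sum.inr (a b)) (by cases b <;> simp)]
      exact hb (a b) (by simpa [hsel] using ha b)

lemma two_pow_le_sens_MUX (n : ℕ) : 2 ^ n ≤ sens (hfExt (MUX n)) := by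
  let x : Fin n ⊕ (Fin n → Bool) → K := Sum.elim (fun _ => none) fun _ => some false
  have hx : hfExt (MUX n) x = some false :=
    (hfExt_MUX_eq_some_iff x false).2 fun _ _ => rfl
  refine le_trans ?_ (le_ciSup (f := sensAt (hfExt (MUX n))) (Set.finite_range _).bddAbove x)
  have hcard : (Set.range (Sum.inr : (Fin n → Bool) → Fin n ⊕ (Fin n → Bool))).ncard = 2 ^ n := by
    rw [← Set.image_univ, Set.ncard_image_of_injective _ Sum.inr_injective, Set.ncard_univ]
    simp
  rw [← hcard]
  refine Set.ncard_le_ncard ?_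
  rintro _ ⟨a, rfl⟩
  refine ⟨Function.update x (Sum.inr a) none, by simp [x],
    fun j hj => Function.update_of_ne hj _ _, ?_⟩
  rw [hx, Ne, hfExt_MUX_eq_some_iff]
  intro h
  simpa using h a fun i => Or.inl (by simp [x])

/-- for `n ≥ 2`, `s_u(MUX_n) = bs_u(MUX_n) = cc_u(MUX_n) = 2^n`. -/
theorem mux_sens_bsens_cc (n : ℕ) (hn : 2 ≤ n) :
    sens (hfExt (MUX n)) = 2 ^ n ∧ bsens (hfExt (MUX n)) = 2 ^ n ∧
      cc (hfExt (MUX n)) = 2 ^ n := by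
  have h₁ := two_pow_le_sens_MUX n
  have h₂ := sens_le_bsens (hfExt (MUX n))
  have h₃ := bsens_le_cc (hfExt (MUX n))
  have h₄ : cc (hfExt (MUX n)) ≤ 2 ^ n := ciSup_le' (ccAt_MUX_le hn)
  omega

end HF
end

section
/- For every Boolean function f : {0,1}^n → {0,1}, the hazard-free certificate complexity and the hazard-free decision tree depth satisfy cc_u(f̃) ≤ depth_u(f) ≤ 4 · cc_u(f̃)^3. -/
namespace HF

variable {ι : Type} [Fintype ι] [DecidableEq ι]

omit [Fintype ι] in
theorem TDT.exists_cert (T : TDT ι) (x : ι → K) :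
    ∃ S : Finset ι, S.card ≤ T.depth ∧ ∀ y : ι → K, (∀ i ∈ S, y i = x i) → T.eval y = T.eval x := by
  induction T with
  | leaf b => exact ⟨∅, by simp, fun _ _ => rfl⟩
  | node i t0 tu t1 h0 hu h1 =>
    have extend : ∀ t : TDT ι, t.depth + 1 ≤ (TDT.node i t0 tu t1).depth →
        (∀ y : ι → K, y i = x i → (TDT.node i t0 tu t1).eval y = t.eval y) →
        (∃ S : Finset ι, S.card ≤ t.depth ∧
          ∀ y : ι → K, (∀ j ∈ S, y j = x j) → t.eval y = t.eval x) →
        ∃ S : Finset ι, S.card ≤ (TDT.node i t0 tu t1).depth ∧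
          ∀ y : ι → K, (∀ j ∈ S, y j = x j) →
            (TDT.node i t0 tu t1).eval y = (TDT.node i t0 tu t1).eval x := by
      rintro t ht he ⟨S, hS, hc⟩
      refine ⟨insert i S, (Finset.card_insert_le _ _).trans (by omega), fun y hy => ?_⟩
      rw [he y (hy i (by simp)), he x rfl]
      exact hc y fun j hj => hy j (by simp [hj])
    rcases hx : x i with _ | _ | _
    · exact extend tu (by simp [TDT.depth]) (fun y hy => by simp [TDT.eval, hy, hx]) hu
    · exact extend t0 (by simp [TDT.depth]) (fun y hy => by simp [TDT.eval, hy, hx]) h0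
    · exact extend t1 (by simp [TDT.depth]) (fun y hy => by simp [TDT.eval, hy, hx]) h1

/-- Some ternary tree of depth at most `d` agrees with `g` on all inputs in `X`. -/
def ComputableOn (g : (ι → K) → K) (X : Set (ι → K)) (d : ℕ) : Prop :=
  ∃ T : TDT ι, T.depth ≤ d ∧ ∀ x ∈ X, T.eval x = g x

omit [Fintype ι] [DecidableEq ι] in
theorem ComputableOn.mono {g : (ι → K) → K} {X Y : Set (ι → K)} {d e : ℕ}
    (h : ComputableOn g Y d) (hXY : X ⊆ Y) (hde : d ≤ e) : ComputableOn g X e := by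
  obtain ⟨T, hT, hc⟩ := h
  exact ⟨T, hT.trans hde, fun x hx => hc x (hXY hx)⟩

omit [Fintype ι] in
/-- Querying all positions in `S` before continuing costs `S.card` additional levels. -/
theorem ComputableOn.of_query {g : (ι → K) → K} {d : ℕ} (S : Finset ι) (X : Set (ι → K))
    (h : ∀ a : ι → K, ComputableOn g (X ∩ {x | ∀ i ∈ S, x i = a i}) d) :
    ComputableOn g X (d + S.card) := by
  induction S using Finset.induction_on generalizing X with
  | empty => simpa using h fun _ => none
  | insert i S hi ih =>
    have hv : ∀ v : K, ComputableOn g (X ∩ {x | x i = v}) (d + S.card) := by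
      refine fun v => ih _ fun a => (h (Function.update a i v)).mono ?_ le_rfl
      rintro x ⟨⟨hX, hxi⟩, hxS⟩
      refine ⟨hX, fun j hj => ?_⟩
      by_cases hji : j = i
      · subst hji; simpa using hxi
      · rw [Function.update_of_ne hji]
        exact hxS j (Finset.mem_of_mem_insert_of_ne hj hji)
    obtain ⟨t0, hd0, hc0⟩ := hv (some false)
    obtain ⟨tu, hdu, hcu⟩ := hv none
    obtain ⟨t1, hd1, hc1⟩ := hv (some true)
    refine ⟨.node i t0 tu t1, ?_, fun x hx => ?_⟩
    · rw [Finset.card_insert_of_notMem hi]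
      simp only [TDT.depth]
      omega
    · rcases hxi : x i with _ | _ | _
      · simpa [TDT.eval, hxi] using hcu x ⟨hx, hxi⟩
      · simpa [TDT.eval, hxi] using hc0 x ⟨hx, hxi⟩
      · simpa [TDT.eval, hxi] using hc1 x ⟨hx, hxi⟩

omit [Fintype ι] in
/-- Certificates of inputs with different values conflict at a common position. -/
theorem exists_conflict {g : (ι → K) → K} {x y : ι → K} {S R : Finset ι}
    (hS : ∀ z : ι → K, (∀ i ∈ S, z i = x i) → g z = g x)
    (hR : ∀ z : ι → K, (∀ i ∈ R, z i = y i) → g z = g y) (hne : g x ≠ g y) :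
    ∃ i ∈ S, i ∈ R ∧ x i ≠ y i := by
  by_contra! h
  refine hne ((hS (fun i => if i ∈ S then x i else y i) fun i hi => if_pos hi).symm.trans
    (hR _ fun i hi => ?_))
  by_cases hiS : i ∈ S
  · simpa [hiS] using h i hiS hi
  · simp [hiS]

/-- If every input extending the answers `a` on the queried positions `Q` has a certificate with
at most `C` positions, of which at most `k c` are unqueried (`c` the value of the input), then
`C * ∑ c, k c` further queries suffice. -/
theorem computableOn_of_certs (g : (ι → K) → K) (C m : ℕ) (k : K → ℕ) (hk : ∑ c, k c ≤ m)
    (Q : Finset ι) (a : ι → K)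
    (h : ∀ x : ι → K, (∀ i ∈ Q, x i = a i) → ∃ S : Finset ι, S.card ≤ C ∧
      (∀ y : ι → K, (∀ i ∈ S, y i = x i) → g y = g x) ∧ (S \ Q).card ≤ k (g x)) :
    ComputableOn g {x | ∀ i ∈ Q, x i = a i} (C * m) := by
  induction m generalizing k Q a with
  | zero =>
    refine ⟨.leaf (g a), by simp [TDT.depth], fun x hx => ?_⟩
    obtain ⟨S, -, hS, hSk⟩ := h a fun _ _ => rfl
    have hk0 : k (g a) = 0 := by
      have := Finset.single_le_sum (f := k) (fun _ _ => Nat.zero_le _) (Finset.mem_univ (g a))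
      omega
    have hsub : S ⊆ Q := Finset.sdiff_eq_empty_iff_subset.1 (Finset.card_eq_zero.1 (by omega))
    exact (hS x fun i hi => hx i (hsub hi)).symm
  | succ m ih =>
    obtain ⟨S, hSC, hS, -⟩ := h a fun _ _ => rfl
    have shrink : ∀ x : ι → K, (∀ i ∈ Q, x i = a i) → g x ≠ g a → ∀ R : Finset ι,
        (∀ y : ι → K, (∀ i ∈ R, y i = x i) → g y = g x) →
        (R \ (Q ∪ S)).card < (R \ Q).card := by
      intro x hx hne R hR
      obtain ⟨i, hiR, hiS, hi⟩ := exists_conflict hR hS hne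
      refine Finset.card_lt_card (Finset.ssubset_iff_of_subset
        (Finset.sdiff_subset_sdiff le_rfl Finset.subset_union_left) |>.2 ⟨i, ?_, ?_⟩)
      · exact Finset.mem_sdiff.2 ⟨hiR, fun hiQ => hi (hx i hiQ)⟩
      · simp [hiS]
    by_cases hconst : ∀ x : ι → K, (∀ i ∈ Q, x i = a i) → g x = g a
    · exact ⟨.leaf (g a), by simp [TDT.depth], fun x hx => (hconst x hx).symm⟩
    push Not at hconst
    obtain ⟨x₀, hx₀, hne₀⟩ := hconst
    have hpos : 0 < k (g x₀) := by
      obtain ⟨R, -, hR, hRk⟩ := h x₀ hx₀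
      have := shrink x₀ hx₀ hne₀ R hR
      omega
    let k' : K → ℕ := fun c => if c = g a then k c else k c - 1
    have hk' : ∑ c, k' c < ∑ c, k c := by
      refine Finset.sum_lt_sum (fun c _ => ?_) ⟨g x₀, Finset.mem_univ _, ?_⟩
      · simp only [k']; split_ifs <;> omega
      · simp only [k', if_neg hne₀]; omega
    refine (ComputableOn.of_query (d := C * m) S _ fun b => ?_).mono subset_rfl
      (by rw [Nat.mul_succ]; omega)
    by_cases hb : ∃ z : ι → K, (∀ i ∈ Q, z i = a i) ∧ ∀ i ∈ S, z i = b i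
    · obtain ⟨z, hzQ, hzS⟩ := hb
      refine (ih k' (by omega) (Q ∪ S) z fun x hx => ?_).mono ?_ le_rfl
      · have hxQ : ∀ i ∈ Q, x i = a i := fun i hi =>
          (hx i (Finset.mem_union_left _ hi)).trans (hzQ i hi)
        obtain ⟨R, hRC, hR, hRk⟩ := h x hxQ
        refine ⟨R, hRC, hR, ?_⟩
        by_cases hxa : g x = g a
        · simp only [k', if_pos hxa]
          exact (Finset.card_le_card
            (Finset.sdiff_subset_sdiff le_rfl Finset.subset_union_left)).trans hRk
        · have := shrink x hxQ hxa R hR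
          simp only [k', if_neg hxa]
          omega
      · rintro x ⟨hxQ, hxS⟩ i hi
        rcases Finset.mem_union.1 hi with hi | hi
        · exact (hxQ i hi).trans (hzQ i hi).symm
        · exact (hxS i hi).trans (hzS i hi).symm
    · exact ⟨.leaf none, by simp [TDT.depth], fun x hx => (hb ⟨x, hx.1, hx.2⟩).elim⟩

omit [DecidableEq ι] in
theorem exists_cert_card_le_cc (g : (ι → K) → K) (x : ι → K) :
    ∃ S : Finset ι, S.card ≤ cc g ∧ ∀ y : ι → K, (∀ i ∈ S, y i = x i) → g y = g x := by
  obtain ⟨S, hS, hc⟩ := Nat.sInf_mem (s := {k : ℕ | ∃ S : Finset ι, S.card = k ∧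
      ∀ y : ι → K, (∀ i ∈ S, y i = x i) → g y = g x})
    ⟨_, Finset.univ, rfl, fun y hy => congrArg g (funext fun i => hy i (Finset.mem_univ i))⟩
  exact ⟨S, hS.trans_le (le_ciSup (f := ccAt g) (Set.finite_range _).bddAbove x), hc⟩

/-- Certificate complexity bounds the depth of some ternary tree quadratically. -/
theorem exists_tree_depth_le (g : (ι → K) → K) :
    ∃ T : TDT ι, ComputesT g T ∧ T.depth ≤ 3 * cc g ^ 2 := by
  obtain ⟨T, hT, hc⟩ := computableOn_of_certs g (cc g) (3 * cc g) (fun _ => cc g) (by simp)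
    ∅ (fun _ => none) fun x _ => by
      obtain ⟨S, hS, hc⟩ := exists_cert_card_le_cc g x
      exact ⟨S, hS, hc, by simpa using hS⟩
  exact ⟨T, fun x => hc x (by simp), hT.trans_eq (by ring)⟩

omit [Fintype ι] in
theorem cc_le_depth {g : (ι → K) → K} {T : TDT ι} (hT : ComputesT g T) : cc g ≤ T.depth := by
  refine ciSup_le fun x => ?_
  obtain ⟨S, hS, hc⟩ := T.exists_cert x
  have hcert : ∀ y : ι → K, (∀ i ∈ S, y i = x i) → g y = g x := fun y hy => by
    rw [← hT y, ← hT x, hc y hy]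
  exact (show ccAt g x ≤ S.card from Nat.sInf_le ⟨S, rfl, hcert⟩).trans hS

/-- `cc_u(f̃) ≤ depth_u(f) ≤ 4·cc_u(f̃)^3`. -/
theorem depth_vs_cc (n : ℕ) (f : (Fin n → Bool) → Bool) :
    cc (hfExt f) ≤ depthU f ∧ depthU f ≤ 4 * (cc (hfExt f)) ^ 3 := by
  obtain ⟨T, hT, hd⟩ := exists_tree_depth_le (hfExt f)
  constructor
  · obtain ⟨T', hT', hd'⟩ := Nat.sInf_mem (s := {d | ∃ T : TDT (Fin n), ComputesHF f T ∧
      T.depth = d}) ⟨_, T, hT, rfl⟩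
    exact (cc_le_depth hT').trans_eq hd'
  · refine ((Nat.sInf_le ⟨T, hT, rfl⟩ : depthU f ≤ T.depth).trans hd).trans ?_
    rcases Nat.eq_zero_or_pos (cc (hfExt f)) with h | h
    · simp [h]
    · exact Nat.mul_le_mul (by norm_num) (Nat.pow_le_pow_right h (by norm_num))

end HF
end

section
/- For every weakly hazard-free function g : K^n → K, the minimum depth of a ternary decision tree computing g satisfies depth_u(g) ≤ cc_u^{(u)}(g) · (cc_u^{(0)}(g) + 1) · (cc_u^{(1)}(g) + 1). -/
namespace HF

variable {ι : Type} [Fintype ι] [DecidableEq ι]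

/-- Every input has a certificate of size at most the certificate complexity of its value. -/
theorem exists_certificate (g : (ι → K) → K) (x : ι → K) :
    ∃ S : Finset ι, S.card ≤ ccVal g (g x) ∧ ∀ y : ι → K, (∀ i ∈ S, y i = x i) → g y = g x := by
  have hne : {k : ℕ | ∃ S : Finset ι, S.card = k ∧
      ∀ y : ι → K, (∀ i ∈ S, y i = x i) → g y = g x}.Nonempty :=
    ⟨_, Finset.univ, rfl, fun y hy => congrArg g (funext fun i => hy i (Finset.mem_univ i))⟩
  obtain ⟨S, hS, hcert⟩ := Nat.sInf_mem hne
  refine ⟨S, ?_, hcert⟩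
  rw [hS]
  exact le_ciSup (f := fun z : {z : ι → K // g z = g x} => ccAt g z.1)
    (Set.finite_range _).bddAbove ⟨x, rfl⟩

/-- Querying all positions of `S` costs at most `S.card` additional levels. -/
theorem exists_tree_of_query (g : (ι → K) → K) (m : ℕ) (S : Finset ι) :
    ∀ (Q : Finset ι) (a : ι → K),
      (∀ a' : ι → K, (∀ i ∈ Q, a' i = a i) → ∃ T : TDT ι, T.depth ≤ m ∧
        ∀ x, (∀ i ∈ Q ∪ S, x i = a' i) → T.eval x = g x) →
      ∃ T : TDT ι, T.depth ≤ S.card + m ∧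
        ∀ x, (∀ i ∈ Q, x i = a i) → T.eval x = g x := by
  induction S using Finset.induction_on with
  | empty =>
    intro Q a h
    simpa using h a fun _ _ => rfl
  | insert j S hj ih =>
    intro Q a h
    by_cases hjQ : j ∈ Q
    · obtain ⟨T, hT, hev⟩ := ih Q a (by
        intro a' ha'
        obtain ⟨T, hT, hev⟩ := h a' ha'
        refine ⟨T, hT, fun x hx => hev x fun i hi => hx i ?_⟩
        simp only [Finset.mem_union, Finset.mem_insert] at hi ⊢
        grind)
      exact ⟨T, by rw [Finset.card_insert_of_notMem hj]; omega, hev⟩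
    · have branch : ∀ v : K, ∃ T : TDT ι, T.depth ≤ S.card + m ∧
          ∀ x, (∀ i ∈ Q, x i = a i) → x j = v → T.eval x = g x := by
        intro v
        obtain ⟨T, hT, hev⟩ := ih (insert j Q) (Function.update a j v) (by
          intro a' ha'
          obtain ⟨T, hT, hev⟩ := h a' (by
            intro i hi
            have hij : i ≠ j := fun e => hjQ (e ▸ hi)
            simpa [hij] using ha' i (Finset.mem_insert_of_mem hi))
          refine ⟨T, hT, fun x hx => hev x fun i hi => hx i ?_⟩
          simp only [Finset.mem_union, Finset.mem_insert] at hi ⊢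
          tauto)
        refine ⟨T, hT, fun x hx hxj => hev x fun i hi => ?_⟩
        by_cases hij : i = j
        · subst hij; simpa using hxj
        · simpa [hij] using hx i (Finset.mem_of_mem_insert_of_ne hi hij)
      obtain ⟨T0, hT0, h0⟩ := branch (some false)
      obtain ⟨Tu, hTu, hu⟩ := branch none
      obtain ⟨T1, hT1, h1⟩ := branch (some true)
      refine ⟨.node j T0 Tu T1, ?_, fun x hx => ?_⟩
      · rw [Finset.card_insert_of_notMem hj]
        simp only [TDT.depth]
        omega
      · rcases hxj : x j with _ | _ | _
        · simpa [TDT.eval, hxj] using hu x hx hxj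
        · simpa [TDT.eval, hxj] using h0 x hx hxj
        · simpa [TDT.eval, hxj] using h1 x hx hxj

/-- If, on the subcube fixing `a` on `Q`, every stable value of a monotone `g` is forced by an
implicant with at most `k` stable positions outside `Q`, then `k` rounds of querying
`u`-certificates determine `g` on that subcube. -/
theorem exists_tree_of_implicants (g : (ι → K) → K)
    (hmono : ∀ x y, Below x y → g x = none ∨ g x = g y) (k : ℕ) :
    ∀ (Q : Finset ι) (a : ι → K),
      (∀ x : ι → K, (∀ i ∈ Q, x i = a i) → g x ≠ none →
        ∃ p, Below p x ∧ g p = g x ∧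
          (Finset.univ.filter fun i => i ∉ Q ∧ p i ≠ none).card ≤ k) →
      ∃ T : TDT ι, T.depth ≤ ccVal g none * k ∧
        ∀ x, (∀ i ∈ Q, x i = a i) → T.eval x = g x := by
  induction k with
  | zero =>
    intro Q a h
    by_cases hx : ∃ x : ι → K, (∀ i ∈ Q, x i = a i) ∧ g x ≠ none
    · obtain ⟨x, hxa, hgx⟩ := hx
      obtain ⟨p, hpx, hgp, hcard⟩ := h x hxa hgx
      refine ⟨.leaf (g p), by simp [TDT.depth], fun y hy => ?_⟩
      have hpy : Below p y := by
        intro i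
        by_cases hi : i ∈ Q
        · rw [hy i hi, ← hxa i hi]
          exact hpx i
        · left
          by_contra hne
          rw [Nat.le_zero, Finset.card_eq_zero, Finset.filter_eq_empty_iff] at hcard
          exact hcard (Finset.mem_univ i) ⟨hi, hne⟩
      exact (hmono p y hpy).resolve_left (hgp ▸ hgx)
    · push Not at hx
      exact ⟨.leaf none, by simp [TDT.depth], fun y hy => (hx y hy).symm⟩
  | succ k ih =>
    intro Q a h
    by_cases hx : ∃ x : ι → K, (∀ i ∈ Q, x i = a i) ∧ g x = none
    · obtain ⟨x, hxa, hgx⟩ := hx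
      obtain ⟨S, hS, hcert⟩ := exists_certificate g x
      rw [hgx] at hS hcert
      obtain ⟨T, hT, hev⟩ := exists_tree_of_query g (ccVal g none * k) S Q a (by
        intro a' ha'
        refine ih (Q ∪ S) a' fun z hz hgz => ?_
        have hza : ∀ i ∈ Q, z i = a i := fun i hi =>
          (hz i (Finset.mem_union_left _ hi)).trans (ha' i hi)
        obtain ⟨p, hpz, hgp, hcard⟩ := h z hza hgz
        refine ⟨p, hpz, hgp, ?_⟩
        obtain ⟨j, hjS, hjQ, hpj⟩ : ∃ j ∈ S, j ∉ Q ∧ p j ≠ none := by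
          by_contra! hno
          let y : ι → K := fun i => if i ∈ Q ∪ S then x i else p i
          have hpy : Below p y := by
            intro i
            by_cases hQ : i ∈ Q
            · simp only [y, Finset.mem_union, hQ, true_or, if_true]
              rw [hxa i hQ, ← hza i hQ]
              exact hpz i
            · by_cases hiS : i ∈ S
              · exact Or.inl (hno i hiS hQ)
              · simp [y, hQ, hiS]
          have hgy : g y = none := hcert y fun i hi => by simp [y, hi]
          rcases hmono p y hpy with h1 | h1
          · exact hgz (hgp ▸ h1)
          · exact hgz (hgp ▸ h1.trans hgy)
        refine Nat.le_of_lt_succ (lt_of_lt_of_le (Finset.card_lt_card ?_) hcard)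
        rw [Finset.ssubset_iff_of_subset (by intro i; simp; tauto)]
        exact ⟨j, by simp [hjQ, hpj], by simp [hjS]⟩)
      refine ⟨T, hT.trans ?_, hev⟩
      rw [Nat.mul_succ]
      omega
    · push Not at hx
      let z : ι → K := fun i => if i ∈ Q then a i else none
      have hz : g z ≠ none := hx z fun i hi => by simp [z, hi]
      refine ⟨.leaf (g z), by simp [TDT.depth], fun y hy => ?_⟩
      refine (hmono z y fun i => ?_).resolve_left hz
      by_cases hi : i ∈ Q
      · simp [z, hi, hy i hi]
      · simp [z, hi]

/-- for weakly hazard-free `g`,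
`depth_u(g) ≤ cc_u^{(u)}(g) · (cc_u^{(0)}(g) + 1) · (cc_u^{(1)}(g) + 1)`. -/
theorem weakly_hf_depth_le (n : ℕ) (g : (Fin n → K) → K) (hg : WeaklyHF g) :
    depthT g ≤ ccVal g none * (ccVal g (some false) + 1) * (ccVal g (some true) + 1) := by
  obtain ⟨T, hT, hev⟩ := exists_tree_of_implicants g hg.1
    (max (ccVal g (some false)) (ccVal g (some true))) ∅ (fun _ => none) (by
      intro x _ hgx
      obtain ⟨S, hS, hcert⟩ := exists_certificate g x
      refine ⟨fun i => if i ∈ S then x i else none, fun i => ?_,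
        hcert _ fun i hi => by simp [hi], ?_⟩
      · by_cases hi : i ∈ S <;> simp [hi]
      · refine (Finset.card_le_card (t := S) fun i hi => ?_).trans (hS.trans ?_)
        · by_contra hiS
          simp [hiS] at hi
        · rcases hb : g x with _ | _ | _
          · exact absurd hb hgx
          · exact le_max_left _ _
          · exact le_max_right _ _)
  have hdepth : depthT g ≤ T.depth :=
    Nat.sInf_le ⟨T, fun x => hev x (by simp), rfl⟩
  refine (hdepth.trans hT).trans ?_
  rw [mul_assoc]
  refine Nat.mul_le_mul_left _ (max_le ?_ ?_) <;> nlinarith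

end HF
end

section
/- For every non-constant Boolean function f : {0,1}^n → {0,1}, the maximum hazard-free sensitivity of f̃ over u-inputs is bounded by twice the Boolean sensitivity minus one: s_u^{(u)}(f̃) ≤ 2·s(f) − 1. -/
namespace HF

variable {ι : Type} [Fintype ι] [DecidableEq ι]

/-- A stable value of `hfExt f y` is the value of `f` on every resolution of `y`. -/
theorem eq_of_hfExt_eq_some {f : (ι → Bool) → Bool} {y : ι → K} {b : Bool}
    (h : hfExt f y = some b) {z : ι → Bool} (hz : Resolves y z) : f z = b := by
  unfold hfExt at h
  split_ifs at h with h1 h2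
  · rw [h1 z hz]; simpa using h
  · rw [h2 z hz]; simpa using h

theorem colorful_of_hfExt_eq_none {f : (ι → Bool) → Bool} {x : ι → K}
    (h : hfExt f x = none) : Colorful f x := by
  unfold hfExt at h
  split_ifs at h with h1 h2
  push Not at h1 h2
  obtain ⟨y, hy, hfy⟩ := h1
  obtain ⟨z, hz, hfz⟩ := h2
  exact ⟨y, z, hy, hz, fun e => by simp_all⟩

theorem Resolves.update {κ : Type} [DecidableEq κ]
    {x : κ → K} {z : κ → Bool} (hz : Resolves x z) (i : κ) (c : Bool)
    {v : K} (hv : v = none ∨ v = some c) :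
    Resolves (Function.update x i v) (Function.update z i c) := by
  intro j
  rcases eq_or_ne j i with rfl | hj
  · simpa using hv
  · simpa [hj] using hz j

theorem Resolves.update_of_none {κ : Type} [DecidableEq κ]
    {x : κ → K} {z : κ → Bool} (hz : Resolves x z) {i : κ}
    (hi : x i = none) (c : Bool) : Resolves x (Function.update z i c) := by
  have h := hz.update i c (v := none) (Or.inl rfl)
  rwa [← hi, Function.update_eq_self] at h

/-- A colorful subcube contains an edge whose endpoints have different values. -/
theorem Colorful.exists_edge {f : (ι → Bool) → Bool} {x : ι → K} (h : Colorful f x) :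
    ∃ z k, Resolves x z ∧ x k = none ∧ f (Function.update z k (!(z k))) ≠ f z := by
  by_contra! hflat
  obtain ⟨y, z, hy, hz, hne⟩ := h
  have key : ∀ T : Finset ι, Resolves x (T.piecewise z y) ∧ f (T.piecewise z y) = f y := by
    intro T
    induction T using Finset.induction_on with
    | empty => simpa using hy
    | insert i T _ ih =>
      obtain ⟨hr, hf⟩ := ih
      rw [Finset.piecewise_insert]
      by_cases he : z i = T.piecewise z y i
      · rw [he, Function.update_eq_self]
        exact ⟨hr, hf⟩
      · have hi : x i = none := by
          rcases hr i with h | h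
          · exact h
          · rcases hz i with h' | h'
            · exact h'
            · exact absurd (Option.some.inj (h'.symm.trans h)) he
        refine ⟨hr.update_of_none hi _, ?_⟩
        rw [Bool.eq_not_of_ne he, hflat _ i hr hi, hf]
  have hall := (key Finset.univ).2
  rw [Finset.piecewise_univ] at hall
  exact hne hall.symm

theorem ncard_sensitive_le_boolSens (f : (ι → Bool) → Bool) (z : ι → Bool) :
    Set.ncard {i : ι | f (Function.update z i (!(z i))) ≠ f z} ≤ boolSens f :=
  le_ciSup (f := fun z : ι → Bool => Set.ncard {i : ι | f (Function.update z i (!(z i))) ≠ f z})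
    (Set.finite_range _).bddAbove z

/-- At a `u`-input, a sensitive position can be set to a stable value that makes the
output stable. -/
theorem exists_update_of_sensitive {f : (ι → Bool) → Bool} {x : ι → K}
    (hx : hfExt f x = none) {i : ι}
    (hi : ∃ y : ι → K, y i ≠ x i ∧ (∀ j, j ≠ i → y j = x j) ∧ hfExt f y ≠ hfExt f x) :
    ∃ c b : Bool, some c ≠ x i ∧
      ∀ z, Resolves x z → f (Function.update z i c) = b := by
  obtain ⟨y, hyi, hyj, hy⟩ := hi
  have hyx : y = Function.update x i (y i) :=
    Function.eq_update_iff.2 ⟨rfl, hyj⟩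
  rw [hx] at hy
  obtain ⟨b, hb⟩ := Option.ne_none_iff_exists'.1 hy
  cases hc : y i with
  | some c =>
    refine ⟨c, b, hc ▸ hyi, fun z hz => eq_of_hfExt_eq_some hb ?_⟩
    rw [hyx, hc]
    exact hz.update i c (Or.inr rfl)
  | none =>
    obtain ⟨z, w, hz, hw, hne⟩ := colorful_of_hfExt_eq_none hx
    have hres : ∀ z, Resolves x z → Resolves y z := fun z hz j => by
      rcases eq_or_ne j i with rfl | hj
      · exact Or.inl hc
      · rw [hyj j hj]; exact hz j
    exact absurd ((eq_of_hfExt_eq_some hb (hres z hz)).trans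
      (eq_of_hfExt_eq_some hb (hres w hw)).symm) hne

/-- The stable outputs obtained by stabilizing different unstable positions agree. -/
theorem stabilized_values_agree {κ : Type} [DecidableEq κ] {f : (κ → Bool) → Bool} {x : κ → K} {z : κ → Bool}
    (hz : Resolves x z) {i j : κ} (hij : i ≠ j) (hxi : x i = none) (hxj : x j = none)
    {c c' b b' : Bool} (hi : ∀ z, Resolves x z → f (Function.update z i c) = b)
    (hj : ∀ z, Resolves x z → f (Function.update z j c') = b') : b = b' := by
  rw [← hi _ (hz.update_of_none hxj c'), ← hj _ (hz.update_of_none hxi c),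
    Function.update_comm hij]

theorem sensAt_le_of_hfExt_eq_none {f : (ι → Bool) → Bool} {x : ι → K}
    (hx : hfExt f x = none) : sensAt (hfExt f) x ≤ 2 * boolSens f - 1 := by
  set S : Set ι :=
    {i | ∃ y : ι → K, y i ≠ x i ∧ (∀ j, j ≠ i → y j = x j) ∧ hfExt f y ≠ hfExt f x}
  obtain ⟨z₀, k, hz₀, hk, hedge⟩ := (colorful_of_hfExt_eq_none hx).exists_edge
  have hsens : ∀ i ∈ S, ∃ c b : Bool, some c ≠ x i ∧
      ∀ z, Resolves x z → f (Function.update z i c) = b :=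
    fun i hi => exists_update_of_sensitive hx hi
  obtain ⟨b, hb⟩ : ∃ b : Bool, ∀ i ∈ S, x i = none →
      ∃ c, ∀ z, Resolves x z → f (Function.update z i c) = b := by
    by_cases hB : ∃ i ∈ S, x i = none
    · obtain ⟨i, hi, hxi⟩ := hB
      obtain ⟨c, b, -, hcb⟩ := hsens i hi
      refine ⟨b, fun j hj hxj => ?_⟩
      rcases eq_or_ne i j with rfl | hij
      · exact ⟨c, hcb⟩
      · obtain ⟨c', b', -, hcb'⟩ := hsens j hj
        exact ⟨c', stabilized_values_agree hz₀ hij hxi hxj hcb hcb' ▸ hcb'⟩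
    · exact ⟨true, fun i hi hxi => absurd ⟨i, hi, hxi⟩ hB⟩
  obtain ⟨z, hz, hfz, hfw⟩ : ∃ z, Resolves x z ∧ f z ≠ b ∧
      f (Function.update z k (!(z k))) = b := by
    by_cases h : f z₀ = b
    · exact ⟨_, hz₀.update_of_none hk _, h ▸ hedge, by simpa using h⟩
    · exact ⟨z₀, hz₀, h,
        (Bool.eq_not_of_ne hedge).trans (Bool.eq_not_of_ne (Ne.symm h)).symm⟩
  set w := Function.update z k (!(z k)) with hw
  have hwres : Resolves x w := hz.update_of_none hk _
  have hkw : k ∈ {i : ι | f (Function.update w i (!(w i))) ≠ f w} := by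
    rw [Set.mem_ofPred_eq, hfw]
    simpa [hw] using hfz
  have hsub : S ⊆ {i : ι | f (Function.update z i (!(z i))) ≠ f z} ∪
      ({i : ι | f (Function.update w i (!(w i))) ≠ f w} \ {k}) := by
    intro i hi
    by_cases hxi : x i = none
    · left
      obtain ⟨c, hc⟩ := hb i hi hxi
      have hci : c = !(z i) := Bool.eq_not_of_ne fun e => hfz (by
        simpa [e] using hc z hz)
      rw [Set.mem_ofPred_eq, ← hci, hc z hz]
      exact hfz.symm
    · obtain ⟨c, b', hc, hcb⟩ := hsens i hi
      have hflip : ∀ p : ι → Bool, Resolves x p → c = !(p i) := fun p hp =>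
        Bool.eq_not_of_ne fun e => hc (by rw [(hp i).resolve_left hxi, e])
      by_cases hbb : b' = b
      · left
        rw [Set.mem_ofPred_eq, ← hflip z hz, hcb z hz, hbb]
        exact hfz.symm
      · right
        refine ⟨?_, fun e => hxi (e ▸ hk)⟩
        rw [Set.mem_ofPred_eq, ← hflip w hwres, hcb w hwres, hfw]
        exact hbb
  have h1 := (Set.ncard_le_ncard hsub).trans (Set.ncard_union_le _ _)
  have h2 := Set.ncard_sdiff_singleton_add_one hkw
  have h3 := ncard_sensitive_le_boolSens f z
  have h4 := ncard_sensitive_le_boolSens f w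
  change S.ncard ≤ _
  omega

/-- `s_u^{(u)}(f̃) ≤ 2·s(f) − 1` for non-constant `f`. -/
theorem sens_u_le_two_bool_sens (n : ℕ) (f : (Fin n → Bool) → Bool)
    (hnc : ∃ x y, f x ≠ f y) :
    sensVal (hfExt f) none ≤ 2 * boolSens f - 1 := by
  exact ciSup_le' fun x => sensAt_le_of_hfExt_eq_none x.2

end HF
end

section
/- Let s ≥ 1 and let f, g : {0,1}^n → {0,1} be Boolean functions whose hazard-free extensions satisfy s_u(f̃) ≤ s and s_u(g̃) ≤ s. If f̃ and g̃ agree on a Hamming ball B(c, 4s) = {y ∈ K^n : D(c, y) ≤ 4s} for some center c ∈ K^n, then f̃ = g̃ on all of K^n (equivalently f = g). That is, a hazard-free extension of hazard-free sensitivity at most s is completely specified by its values on any Hamming ball of radius 4s in K^n. -/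
namespace HF

variable {ι : Type} [Fintype ι] [DecidableEq ι]

/-- The positions at which resetting `y` to the value of `c` changes the value of `F`. -/
def sensitiveTowards (F : (ι → K) → K) (c y : ι → K) : Finset ι :=
  Finset.univ.filter fun i => F (Function.update y i (c i)) ≠ F y

theorem card_sensitiveTowards_le_sens (F : (ι → K) → K) (c y : ι → K) :
    (sensitiveTowards F c y).card ≤ sens F := by
  have hbdd : BddAbove (Set.range fun x : ι → K => sensAt F x) := (Set.finite_range _).bddAbove
  refine le_trans ?_ (le_ciSup hbdd y)
  rw [← Set.ncard_coe_finset]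
  refine Set.ncard_le_ncard (fun i hi => ?_) (Set.toFinite _)
  have hne : F (Function.update y i (c i)) ≠ F y := by simpa [sensitiveTowards] using hi
  refine ⟨Function.update y i (c i), fun h => hne ?_, fun j hj => by simp [hj], hne⟩
  rw [Function.update_self] at h
  rw [h, Function.update_eq_self]

theorem hamm_update_lt {c y : ι → K} {i : ι} (hi : c i ≠ y i) :
    hamm c (Function.update y i (c i)) < hamm c y := by
  refine Set.ncard_lt_ncard ⟨fun j hj => ?_, fun h => ?_⟩ (Set.toFinite _)
  · rcases eq_or_ne j i with rfl | hji
    · exact hi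
    · simpa [hji] using hj
  · simpa using h hi

/-- Functions on `K^ι` of sensitivity at most `s` are determined by their values on any Hamming
ball of radius `2 * s`. -/
theorem eq_of_eqOn_hamm_ball {F G : (ι → K) → K} {s : ℕ} (hF : sens F ≤ s) (hG : sens G ≤ s)
    (c : ι → K) (hagree : ∀ y, hamm c y ≤ 2 * s → F y = G y) (y : ι → K) : F y = G y := by
  induction hr : hamm c y using Nat.strong_induction_on generalizing y with
  | _ r ih =>
  rcases le_or_gt (hamm c y) (2 * s) with hle | hgt
  · exact hagree y hle
  · have hcard : (sensitiveTowards F c y ∪ sensitiveTowards G c y).card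
        < (Finset.univ.filter fun i => c i ≠ y i).card := by
      have hham : (Finset.univ.filter fun i => c i ≠ y i).card = hamm c y := by
        rw [hamm, ← Set.ncard_coe_finset]
        simp
      have := Finset.card_union_le (sensitiveTowards F c y) (sensitiveTowards G c y)
      have := card_sensitiveTowards_le_sens F c y
      have := card_sensitiveTowards_le_sens G c y
      omega
    obtain ⟨i, hi, hins⟩ := Finset.exists_mem_notMem_of_card_lt_card hcard
    have hne : c i ≠ y i := by simpa using hi
    obtain ⟨hFi, hGi⟩ : F (Function.update y i (c i)) = F y ∧
        G (Function.update y i (c i)) = G y := by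
      simpa [sensitiveTowards] using hins
    rw [← hFi, ← hGi]
    exact ih _ (hr ▸ hamm_update_lt hne) _ rfl

/-- a hazard-free extension of sensitivity at most `s` is determined by
its values on any Hamming ball of radius `4s` in `K^n`. -/
theorem determined_by_hamming_ball (n s : ℕ) (hs : 1 ≤ s)
    (f g : (Fin n → Bool) → Bool)
    (hf : sens (hfExt f) ≤ s) (hg : sens (hfExt g) ≤ s) (c : Fin n → K)
    (hagree : ∀ y : Fin n → K, hamm c y ≤ 4 * s → hfExt f y = hfExt g y) :
    ∀ y : Fin n → K, hfExt f y = hfExt g y :=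
  eq_of_eqOn_hamm_ball hf hg c fun y hy => hagree y (by omega)

end HF
end

section
/- Let f : {0,1}^n → {0,1} be a Boolean function with hazard-free extension f̃ satisfying s_u(f̃) ≤ s, let x ∈ K^n, and let S be a subset of the neighborhood N(x) = {y ∈ K^n : D(x, y) = 1} with |S| ≥ 4s + 1. Then the value f̃(x) occurs among {f̃(y) : y ∈ S} at least |S| − 2s times; in particular it occurs strictly more than |S|/2 times, so f̃(x) is the unique most frequently occurring value of f̃ on S. -/
namespace HF

variable {ι : Type} [Fintype ι] [DecidableEq ι]

theorem sensAt_le_sens {κ : Type} [Finite κ] (g : (κ → K) → K) (x : κ → K) :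
    sensAt g x ≤ sens g :=
  le_ciSup (f := fun x => sensAt g x) (Set.finite_range _).bddAbove x

theorem exists_eq_update_of_hamm_eq_one {κ : Type} [DecidableEq κ] {x y : κ → K}
    (h : hamm x y = 1) : ∃ i, y i ≠ x i ∧ y = Function.update x i (y i) := by
  obtain ⟨i, hi⟩ := Set.ncard_eq_one.1 h
  have key : ∀ j, x j ≠ y j ↔ j = i := fun j => Set.ext_iff.1 hi j
  refine ⟨i, ((key i).2 rfl).symm, Function.eq_update_iff.2 ⟨rfl, fun j hj => ?_⟩⟩
  exact (not_not.1 fun hne => hj ((key j).1 hne)).symm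

/-- Each sensitive position accounts for at most two neighbors with a different value. -/
theorem card_filter_ne_le_two_mul_sensAt {κ : Type} [Fintype κ] [DecidableEq κ]
    (g : (κ → K) → K) (x : κ → K) (S : Finset (κ → K)) (hS : ∀ y ∈ S, hamm x y = 1) :
    (S.filter fun y => g y ≠ g x).card ≤ 2 * sensAt g x := by
  classical
  set A : Finset κ := Finset.univ.filter fun i =>
    ∃ y : κ → K, y i ≠ x i ∧ (∀ j, j ≠ i → y j = x j) ∧ g y ≠ g x with hA
  have hcardA : sensAt g x = A.card := by
    rw [sensAt, ← Set.ncard_coe_finset, hA, Finset.coe_filter_univ]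
  have hsub : (S.filter fun y => g y ≠ g x) ⊆
      A.biUnion fun i => (Finset.univ.erase (x i)).image (Function.update x i) := by
    intro y hy
    obtain ⟨hyS, hne⟩ := Finset.mem_filter.1 hy
    obtain ⟨i, hi, hup⟩ := exists_eq_update_of_hamm_eq_one (hS y hyS)
    refine Finset.mem_biUnion.2 ⟨i, Finset.mem_filter.2 ⟨Finset.mem_univ i, y, hi, ?_, hne⟩,
      Finset.mem_image.2 ⟨y i, by simpa using hi, hup.symm⟩⟩
    exact (Function.eq_update_iff.1 hup).2
  rw [hcardA, mul_comm]
  refine (Finset.card_le_card hsub).trans (Finset.card_biUnion_le_card_mul _ _ _ fun i _ => ?_)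
  refine Finset.card_image_le.trans ?_
  simp [Finset.card_erase_of_mem]

/-- on any set `S` of at least `4s+1` neighbors of `x`, the value
`f̃(x)` occurs at least `|S| − 2s` times, hence strictly more than half the time,
and is the unique most frequent value. -/
theorem plurality_of_neighbors (n s : ℕ) (f : (Fin n → Bool) → Bool)
    (hf : sens (hfExt f) ≤ s) (x : Fin n → K) (S : Finset (Fin n → K))
    (hS : ∀ y ∈ S, hamm x y = 1) (hcard : 4 * s + 1 ≤ S.card) :
    S.card - 2 * s ≤ (S.filter fun y => hfExt f y = hfExt f x).card ∧
    S.card < 2 * (S.filter fun y => hfExt f y = hfExt f x).card ∧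
    ∀ b : K, b ≠ hfExt f x →
      (S.filter fun y => hfExt f y = b).card <
        (S.filter fun y => hfExt f y = hfExt f x).card := by
  have hbad := (card_filter_ne_le_two_mul_sensAt (hfExt f) x S hS).trans
    (Nat.mul_le_mul_left 2 ((sensAt_le_sens (hfExt f) x).trans hf))
  have hsum : (S.filter fun y => hfExt f y = hfExt f x).card +
      (S.filter fun y => hfExt f y ≠ hfExt f x).card = S.card :=
    S.card_filter_add_card_filter_not _
  refine ⟨by omega, by omega, fun b hb => ?_⟩
  have hle : (S.filter fun y => hfExt f y = b).card ≤
      (S.filter fun y => hfExt f y ≠ hfExt f x).card :=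
    Finset.card_le_card (Finset.monotone_filter_right S fun y _ hy => hy ▸ hb)
  omega

end HF
end

section
/- Let f : {0,1}^n → {0,1} be a Boolean function and let x ∈ K^n be such that C(x) is a minimal colorful cube for f. Then there exist b ∈ {0,1} and exactly one resolution y of x with f(y) = b, and every other resolution z of x satisfies f(z) = 1 − b. -/
namespace HF

variable {ι : Type} [Fintype ι] [DecidableEq ι]

/-- Membership in a facet of the subcube `C(x)`. -/
theorem resolves_update {κ : Type} [DecidableEq κ] {x : κ → K} {z : κ → Bool}
    (hz : Resolves x z) (i : κ) :
    Resolves (Function.update x i (some (z i))) z := by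
  intro j
  by_cases hj : j = i
  · subst hj
    simp
  · simpa [hj] using hz j

/-- Changing an unstable coordinate of a resolution gives a resolution. -/
theorem Resolves.update_of_eq_none {κ : Type} [DecidableEq κ] {x : κ → K} {z : κ → Bool}
    (hz : Resolves x z) {i : κ} (hi : x i = none) (a : Bool) :
    Resolves x (Function.update z i a) := by
  intro j
  by_cases hj : j = i
  · subst hj
    exact Or.inl hi
  · simpa [hj] using hz j

/-- Any two points lying on monochromatic facets have the same color. -/
theorem eq_of_mono_facets {κ : Type} [DecidableEq κ] {f : (κ → Bool) → Bool} {x : κ → K}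
    {a : κ → Bool} (ha : ∀ i, x i = none → Mono f (Function.update x i (some (a i))))
    {z w : κ → Bool} (hz : Resolves x z) (hw : Resolves x w) {i j : κ}
    (hi : x i = none) (hj : x j = none) (hzi : z i = a i) (hwj : w j = a j) :
    f z = f w := by
  have hp := hz.update_of_eq_none hj (a j)
  have hpi : Function.update z j (a j) i = a i := by
    by_cases hij : i = j
    · subst hij
      simp
    · simpa [hij] using hzi
  have hpj : Function.update z j (a j) j = a j := by simp
  exact (ha i hi _ _ (hzi ▸ resolves_update hz i) (hpi ▸ resolves_update hp i)).trans
    (ha j hj _ _ (by simpa only [hpj] using resolves_update hp j) (hwj ▸ resolves_update hw j))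

/-- a minimal colorful cube contains exactly one point of one color,
all other points having the opposite color. -/
theorem min_colorful_cube_structure (n : ℕ) (f : (Fin n → Bool) → Bool)
    (x : Fin n → K) (h : MinColorful f x) :
    ∃ b : Bool, ∃ y : Fin n → Bool, Resolves x y ∧ f y = b ∧
      ∀ z : Fin n → Bool, Resolves x z → z ≠ y → f z = !b := by
  obtain ⟨⟨p, q, hp, hq, hpq⟩, hmono⟩ := h
  have hfacet : ∀ i, ∃ a : Bool, x i = none → Mono f (Function.update x i (some a)) := by
    intro i
    by_cases hi : x i = none
    · rcases hmono i hi with hm | hm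
      · exact ⟨false, fun _ => hm⟩
      · exact ⟨true, fun _ => hm⟩
    · exact ⟨false, fun h => absurd h hi⟩
  choose a ha using hfacet
  let y : Fin n → Bool := fun i => (x i).getD (!a i)
  have hy : Resolves x y := by
    intro i
    cases hi : x i <;> simp [y, hi]
  have hne : ∀ z, Resolves x z → z ≠ y → ∃ i, x i = none ∧ z i = a i := by
    intro z hz hzy
    obtain ⟨i, hi⟩ := Function.ne_iff.mp hzy
    rcases hz i with hxi | hxi
    · refine ⟨i, hxi, ?_⟩
      simpa [y, hxi] using hi
    · simp [y, hxi] at hi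
  refine ⟨f y, y, hy, rfl, fun z hz hzy => ?_⟩
  by_contra hcon
  have hzfy : f z = f y := by simpa using hcon
  have hconst : ∀ w, Resolves x w → f w = f y := by
    intro w hw
    by_cases hwy : w = y
    · rw [hwy]
    · obtain ⟨i, hi, hwi⟩ := hne w hw hwy
      obtain ⟨j, hj, hzj⟩ := hne z hz hzy
      exact (eq_of_mono_facets ha hw hz hi hj hwi hzj).trans hzfy
  exact hpq ((hconst p hp).trans (hconst q hq).symm)

end HF
end
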